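/- Let m ∈ ℝ, n ∈ ℕ, and let f be a C^n function on ℝ^d such that |f|_{n,m} := sup_{|β|≤n} sup_z |∂^β f(z)| ⟨z⟩^{−m} < ∞, and let g ∈ S(ℝ^d). Then there is a constant C = C(n, m, g) > 0, independent of f, such that sup_{x,ω ∈ ℝ^d} |V_g f(x, ω)| ⟨x⟩^{−m} ⟨ω⟩^n ≤ C |f|_{n,m}. -/

import Mathlib

open scoped Real BigOperators
open Complex MeasureTheory

noncomputable section

/-- The Japanese bracket `⟨x⟩ = (1+|x|²)^{1/2}` with the Euclidean norm on `ℝ^d`. -/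
def jb {d : ℕ} (x : Fin d → ℝ) : ℝ := Real.sqrt (1 + ∑ i, (x i) ^ 2)

/-- Directional derivative operator. -/
def pdir {E : Type*} [NormedAddCommGroup E] [NormedSpace ℝ E] (v : E) (h : E → ℂ) : E → ℂ :=
  fun y => fderiv ℝ h y v

/-- Iterated directional derivatives along a list of directions. -/
def mpdList {E : Type*} [NormedAddCommGroup E] [NormedSpace ℝ E]
    (vs : List E) (h : E → ℂ) : E → ℂ :=
  vs.foldr pdir h

/-- The list of coordinate directions encoding the multi-index `α`. -/
def stdList (d : ℕ) (α : Fin d → ℕ) : List (Fin d → ℝ) :=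
  (List.finRange d).flatMap fun i => List.replicate (α i) (Pi.single i 1)

/-- The multi-index partial derivative `∂^α`. -/
def mpd {d : ℕ} (α : Fin d → ℕ) (h : (Fin d → ℝ) → ℂ) : (Fin d → ℝ) → ℂ :=
  mpdList (stdList d α) h

/-- The short-time Fourier transform `V_g f(x,ω) = ∫ e^{-2πi ω·y} f(y) conj(g(y-x)) dy`. -/
def stft {d : ℕ} (g f : (Fin d → ℝ) → ℂ) (x ω : Fin d → ℝ) : ℂ :=
  ∫ y : Fin d → ℝ,
    Complex.exp (-(2 * π * Complex.I * (∑ i, ω i * y i))) * f y *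
      (starRingEnd ℂ) (g (y - x))

/-- The set of values occurring in the weighted `C^n` seminorm `|f|_{n,m}`. -/
def semSet {d : ℕ} (n : ℕ) (m : ℝ) (f : (Fin d → ℝ) → ℂ) : Set ℝ :=
  {r | ∃ β : Fin d → ℕ, ∃ z : Fin d → ℝ, (∑ i, β i) ≤ n ∧ r = ‖mpd β f z‖ * jb z ^ (-m)}

open LineDeriv in
/-- Directional derivative of a Schwartz function, as a Schwartz function. -/
def schwartzDir {d : ℕ} (v : Fin d → ℝ) (g : SchwartzMap (Fin d → ℝ) ℂ) :
    SchwartzMap (Fin d → ℝ) ℂ :=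
  ∂_{v} g

theorem schwartzDir_apply {d : ℕ} (v : Fin d → ℝ) (g : SchwartzMap (Fin d → ℝ) ℂ)
    (x : Fin d → ℝ) : schwartzDir v g x = fderiv ℝ g x v :=
  SchwartzMap.lineDerivOp_apply_eq_fderiv v g x

theorem one_le_jb {d : ℕ} (x : Fin d → ℝ) : 1 ≤ jb x := by
  unfold jb
  rw [Real.one_le_sqrt]
  linarith [Finset.sum_nonneg fun i (_ : i ∈ Finset.univ) => sq_nonneg (x i)]

theorem jb_pos {d : ℕ} (x : Fin d → ℝ) : 0 < jb x := one_pos.trans_le (one_le_jb x)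

theorem jb_sq {d : ℕ} (x : Fin d → ℝ) : jb x ^ 2 = 1 + ∑ i, x i ^ 2 := by
  unfold jb
  exact Real.sq_sqrt (by positivity)

theorem continuous_jb {d : ℕ} : Continuous (jb : (Fin d → ℝ) → ℝ) := by
  unfold jb
  fun_prop

theorem jb_neg {d : ℕ} (x : Fin d → ℝ) : jb (-x) = jb x := by
  simp [jb]

theorem jb_add_le {d : ℕ} (x y : Fin d → ℝ) : jb (x + y) ≤ 2 * (jb x * jb y) := by
  refine le_of_sq_le_sq ?_ (by have := jb_pos x; have := jb_pos y; positivity)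
  rw [mul_pow, mul_pow, jb_sq, jb_sq, jb_sq]
  have h : ∑ i, (x + y) i ^ 2 ≤ 2 * ∑ i, x i ^ 2 + 2 * ∑ i, y i ^ 2 := by
    rw [Finset.mul_sum, Finset.mul_sum, ← Finset.sum_add_distrib]
    refine Finset.sum_le_sum fun i _ => ?_
    simp only [Pi.add_apply]
    nlinarith [sq_nonneg (x i - y i)]
  have hx : 0 ≤ ∑ i, x i ^ 2 := by positivity
  have hy : 0 ≤ ∑ i, y i ^ 2 := by positivity
  nlinarith [mul_nonneg hx hy]

/-- Peetre's inequality. -/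
theorem jb_rpow_le {d : ℕ} (m : ℝ) (x y : Fin d → ℝ) :
    jb y ^ m ≤ 2 ^ |m| * jb x ^ m * jb (y - x) ^ |m| := by
  have hx := jb_pos x
  have hy := jb_pos y
  have hyx := jb_pos (y - x)
  rcases le_total 0 m with hm | hm
  · rw [abs_of_nonneg hm, ← Real.mul_rpow (by positivity) hx.le,
      ← Real.mul_rpow (by positivity) hyx.le]
    refine Real.rpow_le_rpow hy.le ?_ hm
    simpa [mul_assoc] using jb_add_le x (y - x)
  · rw [abs_of_nonpos hm]
    have h : jb x ^ (-m) ≤ (2 * (jb y * jb (y - x))) ^ (-m) := by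
      refine Real.rpow_le_rpow hx.le ?_ (by linarith)
      have := jb_add_le y (-(y - x))
      rw [jb_neg] at this
      simpa using this
    rw [Real.mul_rpow (by positivity) (by positivity), Real.mul_rpow hy.le hyx.le] at h
    have h2 : jb x ^ m * jb x ^ (-m) = 1 := by
      rw [← Real.rpow_add hx]; simp
    have h3 : jb y ^ m * jb y ^ (-m) = 1 := by
      rw [← Real.rpow_add hy]; simp
    calc jb y ^ m = jb y ^ m * (jb x ^ m * jb x ^ (-m)) := by rw [h2, mul_one]
      _ ≤ jb y ^ m * (jb x ^ m * (2 ^ (-m) * (jb y ^ (-m) * jb (y - x) ^ (-m)))) := by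
        gcongr
      _ = (jb y ^ m * jb y ^ (-m)) * (2 ^ (-m) * jb x ^ m * jb (y - x) ^ (-m)) := by ring
      _ = _ := by rw [h3, one_mul]

theorem jb_le_one_add_norm {d : ℕ} (x : Fin d → ℝ) : jb x ≤ (1 + d) * (1 + ‖x‖) := by
  refine le_of_sq_le_sq ?_ (by positivity)
  rw [jb_sq]
  have h : ∑ i, x i ^ 2 ≤ d * ‖x‖ ^ 2 := by
    refine (Finset.sum_le_card_nsmul Finset.univ _ (‖x‖ ^ 2) fun i _ => ?_).trans_eq (by simp)
    rw [← sq_abs, ← Real.norm_eq_abs]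
    gcongr
    exact norm_le_pi_norm x i
  have hd : (0 : ℝ) ≤ d := by positivity
  have hx := norm_nonneg x
  calc 1 + ∑ i, x i ^ 2 ≤ 1 + d * ‖x‖ ^ 2 := by gcongr
    _ ≤ (1 + d) * (1 + ‖x‖ ^ 2) := by nlinarith [sq_nonneg ‖x‖]
    _ ≤ (1 + d) ^ 2 * (1 + ‖x‖) ^ 2 := by
      gcongr
      · nlinarith
      · nlinarith
    _ = _ := by ring

theorem integrable_jb_rpow_mul {d : ℕ} (r : ℝ) (g : SchwartzMap (Fin d → ℝ) ℂ) :
    Integrable fun u => jb u ^ r * ‖g u‖ := by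
  set k : ℕ := ⌈r⌉₊
  have hint : Integrable fun u : Fin d → ℝ =>
      (1 + d : ℝ) ^ k * 2 ^ k * (‖u‖ ^ 0 * ‖g u‖ + ‖u‖ ^ k * ‖g u‖) :=
    ((g.integrable_pow_mul volume 0).add (g.integrable_pow_mul volume k)).const_mul _
  refine hint.mono' ?_ (Filter.Eventually.of_forall fun u => ?_)
  · refine Continuous.aestronglyMeasurable ?_
    exact (continuous_jb.rpow_const fun u => Or.inl (jb_pos u).ne').mul g.continuous.norm
  · have hu := jb_pos u
    rw [Real.norm_of_nonneg (by positivity), ← add_mul, ← mul_assoc]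
    gcongr
    calc jb u ^ r ≤ jb u ^ (k : ℝ) := Real.rpow_le_rpow_of_exponent_le (one_le_jb u) (Nat.le_ceil r)
      _ = jb u ^ k := Real.rpow_natCast _ _
      _ ≤ ((1 + d) * (1 + ‖u‖)) ^ k := by gcongr; exact jb_le_one_add_norm u
      _ = (1 + d) ^ k * (1 + ‖u‖) ^ k := by rw [mul_pow]
      _ ≤ (1 + d) ^ k * (2 ^ k * (‖u‖ ^ 0 + ‖u‖ ^ k)) := by
        gcongr
        have hn := norm_nonneg u
        rcases le_total ‖u‖ 1 with h | h
        · calc (1 + ‖u‖) ^ k ≤ 2 ^ k := by gcongr; linarith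
            _ ≤ 2 ^ k * (‖u‖ ^ 0 + ‖u‖ ^ k) :=
              le_mul_of_one_le_right (by positivity) (by simp)
        · calc (1 + ‖u‖) ^ k ≤ (2 * ‖u‖) ^ k := by gcongr; linarith
            _ = 2 ^ k * ‖u‖ ^ k := mul_pow _ _ _
            _ ≤ 2 ^ k * (‖u‖ ^ 0 + ‖u‖ ^ k) := by gcongr; simp
      _ = _ := by ring

/-- The oscillating factor `e^{-2πi ω·y}`. -/
def stftChar {d : ℕ} (ω y : Fin d → ℝ) : ℂ :=
  Complex.exp (-(2 * π * Complex.I * (∑ i, ω i * y i)))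

theorem norm_stftChar {d : ℕ} (ω y : Fin d → ℝ) : ‖stftChar ω y‖ = 1 := by
  have : stftChar ω y = Complex.exp (((-(2 * π * ∑ i, ω i * y i) : ℝ) : ℂ) * Complex.I) := by
    unfold stftChar
    congr 1
    push_cast
    ring
  rw [this, Complex.norm_exp_ofReal_mul_I]

theorem hasFDerivAt_stftChar {d : ℕ} (ω y : Fin d → ℝ) :
    HasFDerivAt (stftChar ω)
      (stftChar ω y • (-(2 * π * Complex.I)) •
        (Complex.ofRealCLM.comp (∑ i, ω i • ContinuousLinearMap.proj (R := ℝ) i))) y := by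
  have h : HasFDerivAt (fun y : Fin d → ℝ => -(2 * π * Complex.I) * ((∑ i, ω i * y i : ℝ) : ℂ))
      ((-(2 * π * Complex.I)) •
        (Complex.ofRealCLM.comp (∑ i, ω i • ContinuousLinearMap.proj (R := ℝ) i))) y := by
    refine HasFDerivAt.const_mul ?_ _
    have h := (Complex.ofRealCLM.comp
      (∑ i, ω i • ContinuousLinearMap.proj (R := ℝ) (φ := fun _ : Fin d => ℝ) i)).hasFDerivAt (x := y)
    refine h.congr_of_eventuallyEq (Filter.Eventually.of_forall fun z => ?_)
    simp
  have hexp : ∀ z, stftChar ω z =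
      Complex.exp (-(2 * π * Complex.I) * ((∑ i, ω i * z i : ℝ) : ℂ)) := fun z => by
    unfold stftChar
    congr 1
    push_cast
    ring
  rw [hexp y]
  exact h.cexp.congr_of_eventuallyEq (Filter.Eventually.of_forall hexp)

theorem continuous_stftChar {d : ℕ} (ω : Fin d → ℝ) : Continuous (stftChar ω) := by
  unfold stftChar
  fun_prop

theorem fderiv_stftChar_single {d : ℕ} (ω y : Fin d → ℝ) (i : Fin d) :
    fderiv ℝ (stftChar ω) y (Pi.single i 1) = -(2 * π * Complex.I * ω i) * stftChar ω y := by
  rw [(hasFDerivAt_stftChar ω y).fderiv]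
  simp [Pi.single_apply]
  ring

theorem norm_stft_integrand_le {d : ℕ} {m A : ℝ} (g : SchwartzMap (Fin d → ℝ) ℂ)
    {f : (Fin d → ℝ) → ℂ} (hfA : ∀ z, ‖f z‖ ≤ A * jb z ^ m) (x ω y : Fin d → ℝ) :
    ‖stftChar ω y * f y * (starRingEnd ℂ) (g (y - x))‖ ≤
      A * 2 ^ |m| * jb x ^ m * (jb (y - x) ^ |m| * ‖g (y - x)‖) := by
  have hA : 0 ≤ A := nonneg_of_mul_nonneg_left ((norm_nonneg _).trans (hfA 0))
    (Real.rpow_pos_of_pos (jb_pos _) _)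
  rw [norm_mul, norm_mul, norm_stftChar, one_mul, RCLike.norm_conj]
  calc ‖f y‖ * ‖g (y - x)‖ ≤ (A * jb y ^ m) * ‖g (y - x)‖ := by gcongr; exact hfA y
    _ ≤ (A * (2 ^ |m| * jb x ^ m * jb (y - x) ^ |m|)) * ‖g (y - x)‖ := by
      gcongr; exact jb_rpow_le m x y
    _ = _ := by ring

theorem integrable_stft_integrand {d : ℕ} {m A : ℝ} (g : SchwartzMap (Fin d → ℝ) ℂ)
    {f : (Fin d → ℝ) → ℂ} (hf : Continuous f) (hfA : ∀ z, ‖f z‖ ≤ A * jb z ^ m)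
    (x ω : Fin d → ℝ) :
    Integrable fun y => stftChar ω y * f y * (starRingEnd ℂ) (g (y - x)) := by
  refine Integrable.mono' (((integrable_jb_rpow_mul |m| g).comp_sub_right x).const_mul
    (A * 2 ^ |m| * jb x ^ m)) ?_ (Filter.Eventually.of_forall (norm_stft_integrand_le g hfA x ω))
  exact (((continuous_stftChar ω).mul hf).mul (Complex.continuous_conj.comp
    (g.continuous.comp (continuous_id.sub continuous_const)))).aestronglyMeasurable

theorem norm_stft_le {d : ℕ} {m A : ℝ} (g : SchwartzMap (Fin d → ℝ) ℂ)
    {f : (Fin d → ℝ) → ℂ} (hfA : ∀ z, ‖f z‖ ≤ A * jb z ^ m) (x ω : Fin d → ℝ) :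
    ‖stft g f x ω‖ ≤ (2 ^ |m| * ∫ u, jb u ^ |m| * ‖g u‖) * A * jb x ^ m := by
  refine (norm_integral_le_of_norm_le (((integrable_jb_rpow_mul |m| g).comp_sub_right x).const_mul
    (A * 2 ^ |m| * jb x ^ m))
    (Filter.Eventually.of_forall (norm_stft_integrand_le g hfA x ω))).trans_eq ?_
  rw [integral_const_mul, integral_sub_right_eq_self (fun u => jb u ^ |m| * ‖g u‖)]
  ring

theorem fderiv_mul_conj_translate {d : ℕ} (g : SchwartzMap (Fin d → ℝ) ℂ)
    {f : (Fin d → ℝ) → ℂ} (hf : Differentiable ℝ f) (x v y : Fin d → ℝ) :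
    fderiv ℝ (fun y => f y * (starRingEnd ℂ) (g (y - x))) y v =
      pdir v f y * (starRingEnd ℂ) (g (y - x)) +
        f y * (starRingEnd ℂ) (schwartzDir v g (y - x)) := by
  have hg : HasFDerivAt (fun y => (starRingEnd ℂ) (g (y - x)))
      ((Complex.conjCLE : ℂ →L[ℝ] ℂ).comp (fderiv ℝ g (y - x))) y := by
    have h1 : HasFDerivAt (fun y => g (y - x)) (fderiv ℝ g (y - x)) y :=
      
      (hasFDerivAt_comp_sub x).mpr g.differentiableAt.hasFDerivAt
    exact (Complex.conjCLE : ℂ →L[ℝ] ℂ).hasFDerivAt.comp y h1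
  have hmul : HasFDerivAt (fun y => f y * (starRingEnd ℂ) (g (y - x))) _ y :=
    (hf y).hasFDerivAt.mul hg
  rw [hmul.fderiv, schwartzDir_apply]
  simp [pdir]
  ring

/-- Integration by parts for the short-time Fourier transform. -/
theorem mul_stft_eq {d : ℕ} {m A : ℝ} (g : SchwartzMap (Fin d → ℝ) ℂ)
    {f : (Fin d → ℝ) → ℂ} (hf : ContDiff ℝ 1 f) (i : Fin d)
    (hfA : ∀ z, ‖f z‖ ≤ A * jb z ^ m)
    (hdfA : ∀ z, ‖pdir (Pi.single i 1) f z‖ ≤ A * jb z ^ m) (x ω : Fin d → ℝ) :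
    (2 * π * Complex.I * ω i) * stft g f x ω =
      stft g (pdir (Pi.single i 1) f) x ω + stft (schwartzDir (Pi.single i 1) g) f x ω := by
  have hdf : Continuous (pdir (Pi.single i (1 : ℝ)) f) :=
    (hf.continuous_fderiv one_ne_zero).clm_apply continuous_const
  have hdiff : Differentiable ℝ f := hf.differentiable one_ne_zero
  have i0 := integrable_stft_integrand g hf.continuous hfA x ω
  have i1 := integrable_stft_integrand g hdf hdfA x ω
  have i2 := integrable_stft_integrand (schwartzDir (Pi.single i 1) g) hf.continuous hfA x ω
  have hprod : ∀ y, stftChar ω y *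
      fderiv ℝ (fun y => f y * (starRingEnd ℂ) (g (y - x))) y (Pi.single i 1) =
      stftChar ω y * pdir (Pi.single i 1) f y * (starRingEnd ℂ) (g (y - x)) +
      stftChar ω y * f y * (starRingEnd ℂ) (schwartzDir (Pi.single i 1) g (y - x)) := fun y => by
    rw [fderiv_mul_conj_translate g hdiff]
    ring
  have hchar : ∀ y, fderiv ℝ (stftChar ω) y (Pi.single i 1) *
      (f y * (starRingEnd ℂ) (g (y - x))) =
      -(2 * π * Complex.I * ω i) * (stftChar ω y * f y * (starRingEnd ℂ) (g (y - x))) :=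
    fun y => by
      rw [fderiv_stftChar_single]
      ring
  have key := integral_mul_fderiv_eq_neg_fderiv_mul_of_integrable (μ := volume)
    (f := stftChar ω) (g := fun y => f y * (starRingEnd ℂ) (g (y - x))) (v := Pi.single i 1)
    (by simpa only [hchar] using i0.const_mul _)
    (by simp only [hprod]; exact i1.add i2)
    (by simpa only [mul_assoc] using i0)
    (fun y _ => (hasFDerivAt_stftChar ω y).differentiableAt)
    (fun y _ => (hdiff y).mul (Complex.differentiable_conj.differentiableAt.comp y
      (g.differentiableAt.comp y (differentiableAt_id.sub_const x))))
  simp only [hprod, hchar] at key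
  rw [integral_add i1 i2, integral_const_mul] at key
  rw [neg_mul, neg_neg] at key
  exact key.symm

theorem stft_directional_decay {d : ℕ} (m : ℝ) (i : Fin d) (k : ℕ) :
    ∀ g : SchwartzMap (Fin d → ℝ) ℂ, ∃ C ≥ 0, ∀ (f : (Fin d → ℝ) → ℂ) (A : ℝ), ContDiff ℝ k f →
      (∀ j ≤ k, ∀ z, ‖(pdir (Pi.single i 1))^[j] f z‖ ≤ A * jb z ^ m) →
      ∀ x ω : Fin d → ℝ, ‖stft g f x ω‖ * |ω i| ^ k ≤ C * A * jb x ^ m := by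
  induction k with
  | zero =>
    intro g
    refine ⟨2 ^ |m| * ∫ u, jb u ^ |m| * ‖g u‖, ?_, fun f A _ hA x ω => ?_⟩
    · have : 0 ≤ ∫ u, jb u ^ |m| * ‖g u‖ := integral_nonneg fun u =>
        mul_nonneg (Real.rpow_nonneg (jb_pos u).le _) (norm_nonneg _)
      positivity
    · simpa using norm_stft_le g (hA 0 le_rfl) x ω
  | succ k ih =>
    intro g
    obtain ⟨C₁, hC₁, h₁⟩ := ih g
    obtain ⟨C₂, hC₂, h₂⟩ := ih (schwartzDir (Pi.single i 1) g)
    refine ⟨C₁ + C₂, by positivity, fun f A hf hA x ω => ?_⟩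
    have hdf : ContDiff ℝ k (pdir (Pi.single i (1 : ℝ)) f) :=
      (hf.fderiv_right (m := k) (by norm_cast)).clm_apply contDiff_const
    have e₁ := h₁ (pdir (Pi.single i 1) f) A hdf (fun j hj => hA (j + 1) (by omega)) x ω
    have e₂ := h₂ f A (hf.of_le (by norm_cast; omega)) (fun j hj => hA j (by omega)) x ω
    have key := congrArg norm (mul_stft_eq g (hf.of_le (by norm_cast; omega)) i
      (hA 0 (by omega)) (hA 1 (by omega)) x ω)
    have hle : |ω i| * ‖stft g f x ω‖ ≤ ‖stft g (pdir (Pi.single i 1) f) x ω‖ +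
        ‖stft (schwartzDir (Pi.single i 1) g) f x ω‖ := by
      refine le_trans ?_ (key.le.trans (norm_add_le _ _))
      rw [norm_mul]
      gcongr
      simp only [norm_mul, Complex.norm_I, Complex.norm_real, Real.norm_eq_abs, mul_one,
        Complex.norm_ofNat, abs_of_pos Real.pi_pos]
      nlinarith [Real.pi_gt_three, abs_nonneg (ω i)]
    calc ‖stft g f x ω‖ * |ω i| ^ (k + 1) = (|ω i| * ‖stft g f x ω‖) * |ω i| ^ k := by ring
      _ ≤ (‖stft g (pdir (Pi.single i 1) f) x ω‖ +
          ‖stft (schwartzDir (Pi.single i 1) g) f x ω‖) * |ω i| ^ k := by gcongr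
      _ ≤ (C₁ + C₂) * A * jb x ^ m := by linarith

theorem flatMap_replicate_single {ι α : Type*} [DecidableEq ι] (e : ι → α) (i : ι) (k : ℕ)
    (l : List ι) (hl : l.Nodup) :
    l.flatMap (fun j => List.replicate ((Pi.single i k : ι → ℕ) j) (e j)) =
      if i ∈ l then List.replicate k (e i) else [] := by
  induction l with
  | nil => simp
  | cons a t ih =>
    rw [List.nodup_cons] at hl
    rw [List.flatMap_cons, ih hl.2]
    by_cases h : a = i
    · subst h
      simp [hl.1]
    · simp [h, Ne.symm h]

theorem mpd_single {d : ℕ} (i : Fin d) (k : ℕ) (f : (Fin d → ℝ) → ℂ) :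
    mpd (Pi.single i k) f = (pdir (Pi.single i 1))^[k] f := by
  unfold mpd stdList mpdList
  rw [flatMap_replicate_single (fun j : Fin d => (Pi.single j 1 : Fin d → ℝ)) i k _
    (List.nodup_finRange d), if_pos (List.mem_finRange i)]
  induction k with
  | zero => rfl
  | succ k ih => rw [List.replicate_succ, List.foldr_cons, ih, Function.iterate_succ_apply']

theorem norm_mpd_le_sSup_semSet {d n : ℕ} {m : ℝ} {f : (Fin d → ℝ) → ℂ}
    (hf : BddAbove (semSet n m f)) (β : Fin d → ℕ) (hβ : ∑ i, β i ≤ n) (z : Fin d → ℝ) :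
    ‖mpd β f z‖ ≤ sSup (semSet n m f) * jb z ^ m := by
  have h : ‖mpd β f z‖ * jb z ^ (-m) ≤ sSup (semSet n m f) := le_csSup hf ⟨β, z, hβ, rfl⟩
  rwa [Real.rpow_neg (jb_pos z).le, ← div_eq_mul_inv,
    div_le_iff₀ (Real.rpow_pos_of_pos (jb_pos z) _)] at h

/-- If `f ∈ C^n(ℝ^d)` with `|f|_{n,m} = sup_{|β|≤n} sup_z |∂^β f(z)|⟨z⟩^{-m} < ∞` and
`g ∈ S(ℝ^d)`, then `sup_{x,ω} |V_g f(x,ω)| ⟨x⟩^{-m} ⟨ω⟩^n ≤ C |f|_{n,m}` with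
`C = C(n,m,g)` independent of `f`. -/
theorem stft_decay_of_Cn (d n : ℕ) (m : ℝ) (g : SchwartzMap (Fin d → ℝ) ℂ) :
    ∃ C > 0, ∀ f : (Fin d → ℝ) → ℂ, ContDiff ℝ n f → BddAbove (semSet n m f) →
      ∀ x ω : Fin d → ℝ,
        ‖stft (⇑g) f x ω‖ * jb x ^ (-m) * jb ω ^ (n : ℝ) ≤ C * sSup (semSet n m f) := by
  choose C hC hdecay using fun i : Fin d => stft_directional_decay m i n g
  set B : ℝ := 2 ^ |m| * ∫ u, jb u ^ |m| * ‖g u‖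
  have hB : 0 ≤ B := by
    have : 0 ≤ ∫ u, jb u ^ |m| * ‖g u‖ := integral_nonneg fun u =>
      mul_nonneg (Real.rpow_nonneg (jb_pos u).le _) (norm_nonneg _)
    positivity
  have hS : 0 ≤ ∑ i, C i := Finset.sum_nonneg fun i _ => hC i
  refine ⟨((1 + d) * 2) ^ n * (B + ∑ i, C i + 1), by positivity, fun f hf hbdd x ω => ?_⟩
  set M := sSup (semSet n m f)
  have hder := fun β hβ z => norm_mpd_le_sSup_semSet (z := z) hbdd β hβ
  have hfM : ∀ z, ‖f z‖ ≤ M * jb z ^ m := fun z => by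
    have h0 : stdList d 0 = [] := by simp [stdList, List.flatMap_eq_nil_iff]
    simpa [mpd, h0, mpdList] using hder 0 (by simp) z
  have hM : 0 ≤ M := nonneg_of_mul_nonneg_left ((norm_nonneg _).trans (hfM 0))
    (Real.rpow_pos_of_pos (jb_pos _) _)
  have hJ : 0 < jb x ^ m := Real.rpow_pos_of_pos (jb_pos x) m
  have hmax : ‖stft g f x ω‖ * max 1 ‖ω‖ ^ n ≤ (B + ∑ i, C i + 1) * M * jb x ^ m := by
    rcases le_total ‖ω‖ 1 with h | h
    · rw [max_eq_left h, one_pow, mul_one]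
      refine (norm_stft_le g hfM x ω).trans ?_
      gcongr
      change B ≤ _
      linarith
    · rw [max_eq_right h]
      obtain ⟨i, hi⟩ : ∃ i, ‖ω i‖ = ‖ω‖ := by
        by_contra! hne
        exact lt_irrefl _ ((pi_norm_lt_iff (one_pos.trans_le h)).mpr fun i =>
          (norm_le_pi_norm ω i).lt_of_ne (hne i))
      rw [← hi, Real.norm_eq_abs]
      refine (hdecay i f M hf (fun j hj z => ?_) x ω).trans ?_
      · rw [← mpd_single]
        exact hder _ (by simpa using hj) z
      · gcongr
        have := Finset.single_le_sum (fun i _ => hC i) (Finset.mem_univ i)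
        linarith
  have hω : jb ω ^ n ≤ ((1 + d) * 2) ^ n * max 1 ‖ω‖ ^ n := by
    rw [← mul_pow]
    have hj := jb_pos ω
    gcongr
    refine (jb_le_one_add_norm ω).trans ?_
    rw [mul_assoc]
    gcongr
    linarith [le_max_left 1 ‖ω‖, le_max_right 1 ‖ω‖]
  rw [Real.rpow_natCast, Real.rpow_neg (jb_pos x).le, mul_right_comm, ← div_eq_mul_inv,
    div_le_iff₀ hJ]
  calc ‖stft g f x ω‖ * jb ω ^ n
      ≤ ‖stft g f x ω‖ * (((1 + d) * 2) ^ n * max 1 ‖ω‖ ^ n) := by gcongr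
    _ = ((1 + d) * 2) ^ n * (‖stft g f x ω‖ * max 1 ‖ω‖ ^ n) := by ring
    _ ≤ ((1 + d) * 2) ^ n * ((B + ∑ i, C i + 1) * M * jb x ^ m) := by gcongr
    _ = _ := by ring
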